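/- The operators t_i^{(n)}, e_i^{(n)}, f_i^{(n)} define a representation of U_q′(ŝl_n) on V; that is, for all i, j ∈ {0,…,n−1}: t_i^{(n)} is invertible and t_i^{(n)} t_j^{(n)} = t_j^{(n)} t_i^{(n)}; t_i^{(n)} e_j^{(n)} (t_i^{(n)})^{−1} = q^{a_{ij}} e_j^{(n)} and t_i^{(n)} f_j^{(n)} (t_i^{(n)})^{−1} = q^{−a_{ij}} f_j^{(n)}, where a_{ij} = 2δ(i=j) − δ(j ≡ i+1 mod n) − δ(j ≡ i−1 mod n); e_i^{(n)} f_j^{(n)} − f_j^{(n)} e_i^{(n)} = δ(i=j)·(t_i^{(n)} − (t_i^{(n)})^{−1})/(q − q^{−1}); and for i ≠ j, with m = 1 − a_{ij}, Σ_{k=0}^{m} (−1)^k [m choose k]_q (x_i)^k x_j (x_i)^{m−k} = 0 for x = e^{(n)} and x = f^{(n)}, where [m choose k]_q is the balanced Gaussian binomial coefficient. -/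

import Mathlib

/-!
Shared setup for the `U_q'(sl_n^) × U_q'(sl_l^)`-module
`V = (V_n ⊗ V_l)[z, z⁻¹]` (fix `n > 1`, `l > 1`).

`V` has basis `w(a, b, m)` with `a ∈ {1,…,n}`, `b ∈ {1,…,l}`, `m ∈ ℤ`; we encode
the cyclic index `a` as an element of `ZMod n` (with `n ↔ 0`, so the conventions
`w(0,b,m) = w(n,b,m)` and `w(n+1,b,m) = w(1,b,m)` are automatic) and likewise `b`
as an element of `ZMod l`.  The generator index `i ∈ {0,…,n-1}` is also encoded in
`ZMod n`, so that `δ(i ≡ a mod n)` becomes `a = i` and `δ(i+1 ≡ a mod n)` becomes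
`a = i+1`.  The operators are:

* `tN i w(a,b,m) = q^{δ(a=i) - δ(a=i+1)} w(a,b,m)` (and `tNinv` its inverse),
* `eN i w(a,b,m) = δ(a = i+1) w(a-1, b, m + δ(i=0))`,
* `fN i w(a,b,m) = δ(a = i) w(a+1, b, m - δ(i=0))`,

and `tL, tLinv, eL, fL` are the same formulas with the roles of `(n, a)` and
`(l, b)` exchanged.
-/

noncomputable section

abbrev KK : Type := RatFunc ℚ

/-- the indeterminate `q`. -/
noncomputable def qq : KK := RatFunc.X

/-- index set of the basis of `V`. -/
abbrev BIdx (n l : ℕ) : Type := ZMod n × ZMod l × ℤ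

abbrev VV (n l : ℕ) : Type := BIdx n l →₀ KK

/-- the basis vector `w(a, b, m)`. -/
noncomputable def wB (n l : ℕ) (x : BIdx n l) : VV n l := Finsupp.single x 1

/-- the linear operator sending each basis vector `w(x)` to `g x`. -/
noncomputable def opOf (n l : ℕ) (g : BIdx n l → VV n l) : Module.End KK (VV n l) :=
  Finsupp.lsum KK fun x => LinearMap.toSpanSingleton KK (VV n l) (g x)

noncomputable def tN (n l : ℕ) (i : ZMod n) : Module.End KK (VV n l) :=
  opOf n l fun x =>
    qq ^ (((if x.1 = i then 1 else 0) - (if x.1 = i + 1 then 1 else 0) : ℤ)) • wB n l x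

noncomputable def tNinv (n l : ℕ) (i : ZMod n) : Module.End KK (VV n l) :=
  opOf n l fun x =>
    qq ^ (-((if x.1 = i then 1 else 0) - (if x.1 = i + 1 then 1 else 0) : ℤ)) • wB n l x

noncomputable def eN (n l : ℕ) (i : ZMod n) : Module.End KK (VV n l) :=
  opOf n l fun x =>
    if x.1 = i + 1 then
      wB n l (x.1 - 1, x.2.1, x.2.2 + (if i = 0 then 1 else 0)) else 0

noncomputable def fN (n l : ℕ) (i : ZMod n) : Module.End KK (VV n l) :=
  opOf n l fun x =>
    if x.1 = i then
      wB n l (x.1 + 1, x.2.1, x.2.2 - (if i = 0 then 1 else 0)) else 0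

noncomputable def tL (n l : ℕ) (j : ZMod l) : Module.End KK (VV n l) :=
  opOf n l fun x =>
    qq ^ (((if x.2.1 = j then 1 else 0) - (if x.2.1 = j + 1 then 1 else 0) : ℤ)) • wB n l x

noncomputable def tLinv (n l : ℕ) (j : ZMod l) : Module.End KK (VV n l) :=
  opOf n l fun x =>
    qq ^ (-((if x.2.1 = j then 1 else 0) - (if x.2.1 = j + 1 then 1 else 0) : ℤ)) • wB n l x

noncomputable def eL (n l : ℕ) (j : ZMod l) : Module.End KK (VV n l) :=
  opOf n l fun x =>
    if x.2.1 = j + 1 then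
      wB n l (x.1, x.2.1 - 1, x.2.2 + (if j = 0 then 1 else 0)) else 0

noncomputable def fL (n l : ℕ) (j : ZMod l) : Module.End KK (VV n l) :=
  opOf n l fun x =>
    if x.2.1 = j then
      wB n l (x.1, x.2.1 + 1, x.2.2 - (if j = 0 then 1 else 0)) else 0

/-- the Cartan matrix `a_{ij}` of affine type `A^{(1)}_{n-1}`. -/
def cartan (n : ℕ) (i j : ZMod n) : ℤ :=
  (if i = j then 2 else 0) - (if j = i + 1 then 1 else 0) - (if j = i - 1 then 1 else 0)

/-- the balanced quantum integer `[k]_q = q^{k-1} + q^{k-3} + ⋯ + q^{1-k}`. -/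
noncomputable def qInt (k : ℕ) : KK := ∑ i ∈ Finset.range k, qq ^ ((k : ℤ) - 1 - 2 * i)

/-- the balanced quantum factorial `[m]_q!`. -/
noncomputable def qFact (m : ℕ) : KK := ∏ k ∈ Finset.range m, qInt (k + 1)

/-- the balanced Gaussian binomial coefficient `[m choose k]_q`. -/
noncomputable def qBinom (m k : ℕ) : KK := qFact m / (qFact k * qFact (m - k))

theorem qq_ne_zero : qq ≠ 0 := RatFunc.X_ne_zero

theorem qq_sub_inv_ne_zero : qq - qq⁻¹ ≠ 0 := by
  intro h
  have h1 : qq * qq = 1 := by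
    have := congrArg (qq * ·) h
    simpa [mul_sub, qq_ne_zero, sub_eq_zero] using this
  have h2 : (Polynomial.X * Polynomial.X : Polynomial ℚ) = 1 := by
    apply RatFunc.algebraMap_injective ℚ
    simpa [qq] using h1
  have h3 := congrArg (Polynomial.eval 2) h2
  norm_num at h3

theorem cartan_eq {n : ℕ} (i j : ZMod n) :
    cartan n i j =
      (if i = j then 2 else 0) - (if j = i + 1 then 1 else 0) - (if i = j + 1 then 1 else 0) := by
  simp [cartan, eq_sub_iff_add_eq, eq_comm (a := i) (b := j + 1)]

section Operators

variable {n l : ℕ}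

theorem opOf_wB (g : BIdx n l → VV n l) (x : BIdx n l) : opOf n l g (wB n l x) = g x := by
  simp [opOf, wB]

theorem end_ext {A B : Module.End KK (VV n l)} (h : ∀ x, A (wB n l x) = B (wB n l x)) :
    A = B :=
  Finsupp.lhom_ext' fun x => LinearMap.ext_ring (h x)

theorem tN_wB (i : ZMod n) (x : BIdx n l) : tN n l i (wB n l x) =
    qq ^ (((if x.1 = i then 1 else 0) - (if x.1 = i + 1 then 1 else 0) : ℤ)) • wB n l x :=
  opOf_wB _ x

theorem tNinv_wB (i : ZMod n) (x : BIdx n l) : tNinv n l i (wB n l x) =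
    qq ^ (-((if x.1 = i then 1 else 0) - (if x.1 = i + 1 then 1 else 0) : ℤ)) • wB n l x :=
  opOf_wB _ x

theorem eN_wB (i : ZMod n) (x : BIdx n l) : eN n l i (wB n l x) =
    if x.1 = i + 1 then
      wB n l (x.1 - 1, x.2.1, x.2.2 + (if i = 0 then 1 else 0)) else 0 :=
  opOf_wB _ x

theorem fN_wB (i : ZMod n) (x : BIdx n l) : fN n l i (wB n l x) =
    if x.1 = i then
      wB n l (x.1 + 1, x.2.1, x.2.2 - (if i = 0 then 1 else 0)) else 0 :=
  opOf_wB _ x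

theorem tN_mul_tNinv (i : ZMod n) : tN n l i * tNinv n l i = 1 :=
  end_ext fun x => by
    rw [Module.End.mul_apply, tNinv_wB, map_smul, tN_wB, smul_smul, ← zpow_add₀ qq_ne_zero,
      neg_add_cancel, zpow_zero, one_smul, Module.End.one_apply]

theorem tNinv_mul_tN (i : ZMod n) : tNinv n l i * tN n l i = 1 :=
  end_ext fun x => by
    rw [Module.End.mul_apply, tN_wB, map_smul, tNinv_wB, smul_smul, ← zpow_add₀ qq_ne_zero,
      add_neg_cancel, zpow_zero, one_smul, Module.End.one_apply]

theorem tN_mul_comm (i j : ZMod n) : tN n l i * tN n l j = tN n l j * tN n l i :=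
  end_ext fun x => by
    simp only [Module.End.mul_apply, tN_wB, map_smul]
    rw [smul_comm]

theorem tN_mul_eN_mul_tNinv (i j : ZMod n) :
    tN n l i * eN n l j * tNinv n l i = qq ^ cartan n i j • eN n l j :=
  end_ext fun x => by
    obtain ⟨a, b, m⟩ := x
    simp only [Module.End.mul_apply, tNinv_wB, map_smul, eN_wB, LinearMap.smul_apply]
    by_cases h : a = j + 1
    · subst h
      simp only [if_true]
      rw [tN_wB, smul_smul, ← zpow_add₀ qq_ne_zero]
      congr 2
      simp only [cartan_eq, add_sub_cancel_right, add_left_inj, eq_comm (a := i)]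
      split_ifs <;> ring
    · simp [h]

theorem tN_mul_fN_mul_tNinv (i j : ZMod n) :
    tN n l i * fN n l j * tNinv n l i = qq ^ (-cartan n i j) • fN n l j :=
  end_ext fun x => by
    obtain ⟨a, b, m⟩ := x
    simp only [Module.End.mul_apply, tNinv_wB, map_smul, fN_wB, LinearMap.smul_apply]
    by_cases h : a = j
    · subst h
      simp only [if_true]
      rw [tN_wB, smul_smul, ← zpow_add₀ qq_ne_zero]
      congr 2
      simp only [cartan_eq, add_left_inj, eq_comm (a := i)]
      split_ifs <;> ring
    · simp [h]

theorem eN_mul_fN_sub (hn : 1 < n) (i j : ZMod n) :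
    eN n l i * fN n l j - fN n l j * eN n l i =
      if i = j then (qq - qq⁻¹)⁻¹ • (tN n l i - tNinv n l i) else 0 :=
  end_ext fun x => by
    have : Fact (1 < n) := ⟨hn⟩
    obtain ⟨a, b, m⟩ := x
    by_cases hij : i = j
    · subst hij
      have hq := inv_mul_cancel₀ qq_sub_inv_ne_zero
      have hq' : (qq - qq⁻¹)⁻¹ * (qq⁻¹ - qq) = -1 := by rw [← neg_sub qq, mul_neg, hq]
      simp only [LinearMap.sub_apply, Module.End.mul_apply, fN_wB, eN_wB, if_true,
        LinearMap.smul_apply, tN_wB, tNinv_wB, ← sub_smul, smul_smul]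
      by_cases h1 : a = i
      · subst h1
        simp [eN_wB, hq]
      · by_cases h2 : a = i + 1
        · subst h2
          simp [fN_wB, hq']
        · simp [h1, h2]
    · simp only [LinearMap.sub_apply, Module.End.mul_apply, fN_wB, eN_wB, if_neg hij,
        LinearMap.zero_apply]
      have h1 : eN n l i (if a = j then
          wB n l (a + 1, b, m - (if j = 0 then 1 else 0)) else 0) = 0 := by
        by_cases h : a = j <;> simp [h, eN_wB, Ne.symm hij]
      have h2 : fN n l j (if a = i + 1 then
          wB n l (a - 1, b, m + (if i = 0 then 1 else 0)) else 0) = 0 := by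
        by_cases h : a = i + 1 <;> simp [h, fN_wB, hij]
      rw [h1, h2, sub_zero]

theorem eN_mul_eN_eq_zero {i j : ZMod n} (h : j ≠ i + 1) : eN n l i * eN n l j = 0 :=
  end_ext fun x => by
    rw [Module.End.mul_apply, eN_wB]
    by_cases hx : x.1 = j + 1 <;> simp [hx, eN_wB, h]

theorem fN_mul_fN_eq_zero {i j : ZMod n} (h : i ≠ j + 1) : fN n l i * fN n l j = 0 :=
  end_ext fun x => by
    rw [Module.End.mul_apply, fN_wB]
    by_cases hx : x.1 = j <;> simp [hx, fN_wB, h.symm]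

end Operators

/-- If `x` squares to zero and the words `x y`, `y x` (resp. `x y x`) vanish when `m = 1`
(resp. `m = 2`), then every word in the quantum Serre relation of degree `m ≥ 1` vanishes. -/
theorem pow_mul_mul_pow_eq_zero {R : Type*} [Ring R] {x y : R} (hx : x * x = 0) {m k : ℕ}
    (hm : m ≠ 0) (hk : k ≤ m) (h1 : m = 1 → x * y = 0 ∧ y * x = 0)
    (h2 : m = 2 → x * y * x = 0) : x ^ k * y * x ^ (m - k) = 0 := by
  have hp : ∀ r, 2 ≤ r → x ^ r = 0 := fun r hr =>
    pow_eq_zero_of_le hr (by rw [pow_two, hx])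
  by_cases hk2 : 2 ≤ k
  · simp [hp k hk2]
  by_cases hmk : 2 ≤ m - k
  · simp [hp _ hmk]
  have : (m = 1 ∧ k = 0) ∨ (m = 1 ∧ k = 1) ∨ (m = 2 ∧ k = 1) := by omega
  rcases this with ⟨rfl, rfl⟩ | ⟨rfl, rfl⟩ | ⟨rfl, rfl⟩
  · simpa using (h1 rfl).2
  · simpa using (h1 rfl).1
  · simpa using h2 rfl

/-- the operators `tN, eN, fN` define a representation of
`U_q'(sl_n^)` on `V`: the `t`'s are invertible and commute, conjugation by `t`
rescales `e, f` by `q^{±a_{ij}}`, the `[e_i, f_j]` relation holds, and the quantum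
Serre relations hold (with `m = 1 - a_{ij}` for `i ≠ j`). -/
theorem stmt_14 (n l : ℕ) (hn : 1 < n) (hl : 1 < l) :
    ∀ i j : ZMod n,
      (tN n l i * tNinv n l i = 1 ∧ tNinv n l i * tN n l i = 1) ∧
      (tN n l i * tN n l j = tN n l j * tN n l i) ∧
      (tN n l i * eN n l j * tNinv n l i = qq ^ cartan n i j • eN n l j) ∧
      (tN n l i * fN n l j * tNinv n l i = qq ^ (- cartan n i j) • fN n l j) ∧
      (eN n l i * fN n l j - fN n l j * eN n l i =
        if i = j then (qq - qq⁻¹)⁻¹ • (tN n l i - tNinv n l i) else 0) ∧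
      (i ≠ j →
        ∀ m : ℕ, (m : ℤ) = 1 - cartan n i j →
        (∑ k ∈ Finset.range (m + 1),
          ((-1 : KK) ^ k * qBinom m k) • (eN n l i ^ k * eN n l j * eN n l i ^ (m - k))
            = 0) ∧
        (∑ k ∈ Finset.range (m + 1),
          ((-1 : KK) ^ k * qBinom m k) • (fN n l i ^ k * fN n l j * fN n l i ^ (m - k))
            = 0)) := by
  intro i j
  refine ⟨⟨tN_mul_tNinv i, tNinv_mul_tN i⟩, tN_mul_comm i j, tN_mul_eN_mul_tNinv i j,
    tN_mul_fN_mul_tNinv i j, eN_mul_fN_sub hn i j, fun hij m hm => ?_⟩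
  have : Fact (1 < n) := ⟨hn⟩
  have hself : i ≠ i + 1 := by simp
  rw [cartan_eq, if_neg hij] at hm
  have hm0 : m ≠ 0 := by rintro rfl; split_ifs at hm <;> simp at hm
  have hm1 : m = 1 → j ≠ i + 1 ∧ i ≠ j + 1 := by
    refine fun h => ⟨fun h' => ?_, fun h' => ?_⟩ <;>
      rw [if_pos h'] at hm <;> split_ifs at hm <;> omega
  have hm2 : m = 2 → j ≠ i + 1 ∨ i ≠ j + 1 := by
    intro h
    by_contra! h'
    rw [if_pos h'.1, if_pos h'.2] at hm
    omega
  have he (k : ℕ) (hk : k ≤ m) : eN n l i ^ k * eN n l j * eN n l i ^ (m - k) = 0 := by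
    refine pow_mul_mul_pow_eq_zero (x := eN n l i) (y := eN n l j)
      (eN_mul_eN_eq_zero hself) hm0 hk
      (fun h => ⟨eN_mul_eN_eq_zero (hm1 h).1, eN_mul_eN_eq_zero (hm1 h).2⟩) fun h => ?_
    rcases hm2 h with h | h
    · rw [eN_mul_eN_eq_zero h, zero_mul]
    · rw [mul_assoc, eN_mul_eN_eq_zero h, mul_zero]
  have hf (k : ℕ) (hk : k ≤ m) : fN n l i ^ k * fN n l j * fN n l i ^ (m - k) = 0 := by
    refine pow_mul_mul_pow_eq_zero (x := fN n l i) (y := fN n l j)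
      (fN_mul_fN_eq_zero hself) hm0 hk
      (fun h => ⟨fN_mul_fN_eq_zero (hm1 h).2, fN_mul_fN_eq_zero (hm1 h).1⟩) fun h => ?_
    rcases hm2 h with h | h
    · rw [mul_assoc, fN_mul_fN_eq_zero h, mul_zero]
    · rw [fN_mul_fN_eq_zero h, zero_mul]
  constructor <;> refine Finset.sum_eq_zero fun k hk => ?_
  · rw [he k (Finset.mem_range_succ_iff.1 hk), smul_zero]
  · rw [hf k (Finset.mem_range_succ_iff.1 hk), smul_zero]
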